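/- Let C ≥ 1 and define, for a logit vector l : Fin C → ℝ, the softmax scores S_c(l) = exp(l c) / ∑_{c'} exp(l c') and the Entropic Open-Set loss J_E(l) = -(1/C) ∑_c log S_c(l). If all logit values are equal (∀ c c', l c = l c'), then all softmax scores are equal, S_c(l) = 1/C for every c, and J_E(l) attains its minimum: J_E(l) = log C ≤ J_E(l') for every logit vector l' : Fin C → ℝ. -/

import Mathlib

/-- Softmax scores of a logit vector. -/
noncomputable def softmax {C : ℕ} (l : Fin C → ℝ) (c : Fin C) : ℝ :=
  Real.exp (l c) / ∑ c', Real.exp (l c')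

/-- The Entropic Open-Set loss on an unknown sample. -/
noncomputable def entropicOpenSetLoss {C : ℕ} (l : Fin C → ℝ) : ℝ :=
  -(1 / (C : ℝ)) * ∑ c, Real.log (softmax l c)

theorem softmax_pos {C : ℕ} (l : Fin C → ℝ) (c : Fin C) : 0 < softmax l c :=
  div_pos (Real.exp_pos _) (Finset.sum_pos (fun _ _ => Real.exp_pos _) ⟨c, Finset.mem_univ c⟩)

theorem sum_softmax {C : ℕ} (hC : 1 ≤ C) (l : Fin C → ℝ) : ∑ c, softmax l c = 1 := by
  have hsum : 0 < ∑ c, Real.exp (l c) :=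
    Finset.sum_pos (fun _ _ => Real.exp_pos _) ⟨⟨0, hC⟩, Finset.mem_univ _⟩
  simp only [softmax]
  rw [← Finset.sum_div, div_self hsum.ne']

theorem log_card_le_entropicOpenSetLoss {C : ℕ} (hC : 1 ≤ C) (l : Fin C → ℝ) :
    Real.log C ≤ entropicOpenSetLoss l := by
  have hpos : (0 : ℝ) < C := by exact_mod_cast hC
  have hlog : ∀ c, Real.log (softmax l c) ≤ C * softmax l c - 1 - Real.log C := fun c => by
    have h := Real.log_le_sub_one_of_pos (mul_pos hpos (softmax_pos l c))
    rw [Real.log_mul hpos.ne' (softmax_pos l c).ne'] at h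
    linarith
  have hsum : ∑ c, Real.log (softmax l c) ≤ -(C * Real.log C) := by
    refine (Finset.sum_le_sum fun c _ => hlog c).trans_eq ?_
    simp [Finset.sum_sub_distrib, ← Finset.mul_sum, sum_softmax hC]
  calc Real.log C = -(1 / (C : ℝ)) * -(C * Real.log C) := by field_simp
    _ ≤ entropicOpenSetLoss l :=
      mul_le_mul_of_nonpos_left hsum (neg_nonpos.mpr (one_div_pos.mpr hpos).le)

/-- **Lemma 2.** If all logit values are equal, then all softmax scores equal `1/C`
and the Entropic Open-Set loss attains its minimum value `log C`. -/
theorem equal_logits_minimize_entropic_loss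
    (C : ℕ) (hC : 1 ≤ C) (l : Fin C → ℝ)
    (heq : ∀ c c' : Fin C, l c = l c') :
    (∀ c, softmax l c = 1 / (C : ℝ)) ∧
      entropicOpenSetLoss l = Real.log C ∧
      ∀ l' : Fin C → ℝ, Real.log C ≤ entropicOpenSetLoss l' := by
  have hpos : (0 : ℝ) < C := by exact_mod_cast hC
  have hsoftmax : ∀ c, softmax l c = 1 / (C : ℝ) := fun c => by
    simp only [softmax, fun c' => heq c' c, Finset.sum_const, Finset.card_univ, Fintype.card_fin,
      nsmul_eq_mul]
    field_simp
  refine ⟨hsoftmax, ?_, log_card_le_entropicOpenSetLoss hC⟩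
  simp only [entropicOpenSetLoss, hsoftmax, one_div, Real.log_inv, Finset.sum_const,
    Finset.card_univ, Fintype.card_fin, nsmul_eq_mul]
  field_simp
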